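/- arXiv:1005.0682 — 2 statements merged into one kernel-verified Lean document; each statement's English description precedes it below -/
import Mathlib

section
/- Let m = 4 and suppose α₁, α₂, α₃ ∈ N₂ satisfy α₁ • j = −j + 1, α₂ • j = j + 2, α₃ • j = −j + 3 for all j ∈ ZMod 4, and N₂ is generated by N₀ ∪ {α₁, α₂, α₃} (so N₂/N₀ ≅ ℤ₂ × ℤ₂ and N₁ = N₀). Then every equivariant pointwise clutching map ψ ∈ 𝒜 is uniquely determined by the pair (ψ₀, ψ₃): the evaluation map 𝒜 → Hom(W 0, W 1) × Hom(W 3, W 0), ψ ↦ (ψ₀, ψ₃), is injective (so 𝒜 is homeomorphic to its image 𝒜^{0,3}). -/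
noncomputable section

namespace EqClutch

variable {m : ℕ}

/-- The iterate `Ψ_j^k = ψ_{j+k-1} ∘ ⋯ ∘ ψ_{j+1} ∘ ψ_j : W j ≃ W (j+k)` of a pointwise
preclutching map `ψ`. -/
def Psi {V : Type*} [AddCommGroup V] [Module ℂ V] (W : ZMod m → Submodule ℂ V)
    (ψ : ∀ j : ZMod m, W j ≃ₗ[ℂ] W (j + 1)) :
    ∀ (j : ZMod m) (k : ℕ), W j ≃ₗ[ℂ] W (j + (k : ZMod m))
  | j, 0 => LinearEquiv.ofEq _ _ (by norm_num)
  | j, (k + 1) =>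
      ((Psi W ψ j k).trans (ψ (j + (k : ZMod m)))).trans
        (LinearEquiv.ofEq _ _ (by rw [Nat.cast_add, Nat.cast_one, add_assoc]))

/-- `g` lies in the kernel `N₀` of the action of `N₂` on `ZMod m`. -/
def InKernel (N₂ : Type*) [Group N₂] [MulAction N₂ (ZMod m)] (g : N₂) : Prop :=
  ∀ j : ZMod m, g • j = j

/-- `B : p ≃ q` commutes with `ρ g` (equivariance, stated via the ambient space `V`). -/
def IsEquivariantOn {N₂ : Type*} [Group N₂] {V : Type*} [AddCommGroup V] [Module ℂ V]
    (ρ : N₂ →* (V ≃ₗ[ℂ] V)) {p q : Submodule ℂ V} (B : p ≃ₗ[ℂ] q) (g : N₂) : Prop :=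
  ∀ (w w' : p), (w' : V) = ρ g (w : V) → ((B w' : V) = ρ g ((B w : V)))

/-- A pointwise preclutching map `ψ` is an *equivariant pointwise clutching map*:
(1) `Ψ_j^m = id` for every `j`; (2) for every `j₁` and `g ∈ N₂`, with `j₂ = g⁻¹ • j₁`,
`j₃ = g • (j₂ + 1)` and `k ∈ {0, …, m-1}` the representative of `j₃ - j₁`, one has
`Ψ_{j₁}^k = ρ(g) ∘ ψ_{j₂} ∘ ρ(g)⁻¹` as maps `W j₁ → W j₃`. -/
def IsClutch {N₂ : Type*} [Group N₂] [MulAction N₂ (ZMod m)]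
    {V : Type*} [AddCommGroup V] [Module ℂ V]
    (ρ : N₂ →* (V ≃ₗ[ℂ] V)) (W : ZMod m → Submodule ℂ V)
    (ψ : ∀ j : ZMod m, W j ≃ₗ[ℂ] W (j + 1)) : Prop :=
  (∀ (j : ZMod m) (w : W j), ((Psi W ψ j m) w : V) = (w : V)) ∧
  (∀ (j₁ : ZMod m) (g : N₂) (w₁ : W j₁) (w₂ : W (g⁻¹ • j₁)),
      (w₂ : V) = ρ g⁻¹ (w₁ : V) →
      ((Psi W ψ j₁ ((g • (g⁻¹ • j₁ + 1) - j₁).val)) w₁ : V) =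
        ρ g (((ψ (g⁻¹ • j₁)) w₂ : V)))


theorem coe_apply_congr {V : Type*} [AddCommGroup V] [Module ℂ V] {W : ZMod m → Submodule ℂ V}
    (ψ : ∀ j : ZMod m, W j ≃ₗ[ℂ] W (j + 1)) {j j' : ZMod m} (h : j = j') (w : W j) (w' : W j')
    (hw : (w : V) = (w' : V)) : (ψ j w : V) = (ψ j' w' : V) := by
  subst h
  rw [Subtype.ext hw]

theorem coe_Psi_one {V : Type*} [AddCommGroup V] [Module ℂ V] {W : ZMod m → Submodule ℂ V}
    (ψ : ∀ j : ZMod m, W j ≃ₗ[ℂ] W (j + 1)) (j : ZMod m) (w : W j) :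
    (Psi W ψ j 1 w : V) = (ψ j w : V) := by
  simp only [Psi, LinearEquiv.trans_apply, LinearEquiv.coe_ofEq_apply]
  exact coe_apply_congr ψ (by simp) _ _ rfl

/-- If `g` acts on `ZMod m` as a translation, then conjugation by `ρ g` carries the value of an
equivariant pointwise clutching map at `g⁻¹ • j` to its value at `j`. -/
theorem IsClutch.coe_apply_of_translation {N₂ : Type*} [Group N₂] [MulAction N₂ (ZMod m)]
    (hm : 1 < m) {V : Type*} [AddCommGroup V] [Module ℂ V] {ρ : N₂ →* (V ≃ₗ[ℂ] V)}
    {W : ZMod m → Submodule ℂ V} {ψ : ∀ j : ZMod m, W j ≃ₗ[ℂ] W (j + 1)} (hψ : IsClutch ρ W ψ)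
    {g : N₂} {c : ZMod m} (hg : ∀ j : ZMod m, g • j = j + c) (j : ZMod m) (w : W j)
    (w' : W (g⁻¹ • j)) (hw : (w' : V) = ρ g⁻¹ (w : V)) :
    (ψ j w : V) = ρ g (ψ (g⁻¹ • j) w' : V) := by
  have hk : (g • (g⁻¹ • j + 1) - j).val = 1 := by
    have h : g⁻¹ • j + c = j := by rw [← hg, smul_inv_smul]
    have h' : g • (g⁻¹ • j + 1) - j = 1 := by
      rw [hg, add_right_comm, h, add_sub_cancel_left]
    have : Fact (1 < m) := ⟨hm⟩
    rw [h', ZMod.val_one]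
  have h := hψ.2 j g w w' hw
  rwa [hk, coe_Psi_one] at h

/-- Let `m = 4`, and suppose `α₁ • j = -j + 1`, `α₂ • j = j + 2`,
`α₃ • j = -j + 3` and `N₂ = ⟨N₀, α₁, α₂, α₃⟩` (so `N₂/N₀ ≅ ℤ₂ × ℤ₂`).  Then every
equivariant pointwise clutching map is uniquely determined by the pair `(ψ₀, ψ₃)`:
the evaluation map `𝒜 → Hom(W 0, W 1) × Hom(W 3, W 0)` is injective. -/
theorem stmt_11 {N₂ : Type*} [Group N₂] [MulAction N₂ (ZMod 4)]
    {V : Type*} [AddCommGroup V] [Module ℂ V] [FiniteDimensional ℂ V]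
    (ρ : N₂ →* (V ≃ₗ[ℂ] V)) (W : ZMod 4 → Submodule ℂ V)
    (hIndep : ∀ j : ZMod 4, Disjoint (W j) (⨆ k : ZMod 4, ⨆ (_ : k ≠ j), W k))
    (hSpan : (⨆ j : ZMod 4, W j) = ⊤)
    (hWρ : ∀ (g : N₂) (j : ZMod 4), (W j).map (ρ g).toLinearMap = W (g • j))
    (hfib : ∀ j j' : ZMod 4, ∃ e : W j ≃ₗ[ℂ] W j',
      ∀ g : N₂, InKernel (m := 4) N₂ g → IsEquivariantOn ρ e g)
    (α₁ α₂ α₃ : N₂)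
    (hα₁ : ∀ j : ZMod 4, α₁ • j = -j + 1)
    (hα₂ : ∀ j : ZMod 4, α₂ • j = j + 2)
    (hα₃ : ∀ j : ZMod 4, α₃ • j = -j + 3)
    (hgen : Subgroup.closure ({g : N₂ | InKernel (m := 4) N₂ g} ∪ {α₁, α₂, α₃}) = ⊤) :
    Function.Injective
      (fun ψ : {ψ : ∀ j : ZMod 4, W j ≃ₗ[ℂ] W (j + 1) // IsClutch ρ W ψ} =>
        (ψ.1 0, ψ.1 3)) := by
  rintro ⟨ψ, hψ⟩ ⟨φ, hφ⟩ h
  obtain ⟨h₀, h₃⟩ : ψ 0 = φ 0 ∧ ψ 3 = φ 3 := Prod.mk.inj h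
  have transport : ∀ j : ZMod 4, ψ (α₂⁻¹ • j) = φ (α₂⁻¹ • j) → ψ j = φ j := by
    intro j hj
    ext w
    have hmem : ρ α₂⁻¹ (w : V) ∈ W (α₂⁻¹ • j) := by
      rw [← hWρ]
      exact Submodule.mem_map_of_mem w.2
    rw [hψ.coe_apply_of_translation (by norm_num) hα₂ j w ⟨_, hmem⟩ rfl,
      hφ.coe_apply_of_translation (by norm_num) hα₂ j w ⟨_, hmem⟩ rfl, hj]
  have hinv₁ : α₂⁻¹ • (1 : ZMod 4) = 3 := by
    rw [inv_smul_eq_iff, hα₂]; decide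
  have hinv₂ : α₂⁻¹ • (2 : ZMod 4) = 0 := by
    rw [inv_smul_eq_iff, hα₂]; decide
  have h₁ : ψ 1 = φ 1 := transport 1 (by rw [hinv₁]; exact h₃)
  have h₂ : ψ 2 = φ 2 := transport 2 (by rw [hinv₂]; exact h₀)
  refine Subtype.ext (funext fun j => ?_)
  change ψ j = φ j
  fin_cases j
  · exact h₀
  · exact h₁
  · exact h₂
  · exact h₃

end EqClutch
end
end

section
/- Let ψ ∈ 𝒜 and let j, j' ∈ ZMod m with j ≠ j'; let k, k' ∈ {1,…,m−1} represent j' − j and j − j' respectively, and set B := Ψ_j^k : W j ≃ W j', B' := Ψ_{j'}^{k'} : W j' ≃ W j. Let P := {g ∈ N₂ : g • j = j and g • j' = j'} ∪ {g ∈ N₂ : g • j = j' and g • j' = j} (the subgroup of N₂ preserving {j, j'}). Then: (a) B' = B⁻¹; ρ(g) ∘ B ∘ ρ(g)⁻¹ = B for every g ∈ P with g • j = j, and ρ(g) ∘ B ∘ ρ(g)⁻¹ = B⁻¹ (as maps W j' → W j) for every g ∈ P with g • j = j' (so the pair (B, B⁻¹) is an equivariant pointwise clutching map for the restricted bundle over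 {x_j, x_{j'}} with respect to P); and (b) with U' ⊆ V the ℂ-span of {w − B(w) : w ∈ W j}, both U_ψ and U' are P-invariant and there is a P-equivariant ℂ-linear isomorphism V ⧸ U_ψ ≃ (W j + W j') ⧸ U' between the induced P-representations. -/
noncomputable section

namespace EqClutch

variable {m : ℕ}

/-- Linear maps on an independent spanning family of subspaces glue to the ambient space. -/
theorem exists_linearMap_of_iSupIndep {ι R M M' : Type*} [DecidableEq ι] [Ring R]
    [AddCommGroup M] [Module R M] [AddCommGroup M'] [Module R M'] {W : ι → Submodule R M}
    (hIndep : iSupIndep W) (hSpan : (⨆ i, W i) = ⊤) (f : ∀ i, W i →ₗ[R] M') :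
    ∃ F : M →ₗ[R] M', ∀ (i : ι) (w : W i), F w = f i w := by
  have h := DirectSum.isInternal_submodule_of_iSupIndep_of_iSup_eq_top hIndep hSpan
  let E := LinearEquiv.ofBijective (DirectSum.coeLinearMap W) h
  refine ⟨(DirectSum.toModule R ι M' f).comp E.symm.toLinearMap, fun i w ↦ ?_⟩
  have hE : E.symm (w : M) = DirectSum.lof R ι (fun i ↦ W i) i w := by
    rw [LinearEquiv.symm_apply_eq]
    exact (DirectSum.coeLinearMap_lof W i w).symm
  simp [hE]

section Extension

variable {V : Type*} [AddCommGroup V] [Module ℂ V] {W : ZMod m → Submodule ℂ V}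
  {ψ : ∀ j : ZMod m, W j ≃ₗ[ℂ] W (j + 1)} {T : V →ₗ[ℂ] V}

theorem coe_Psi_eq_pow (hT : ∀ (i : ZMod m) (w : W i), T w = ψ i w) (j : ZMod m) (k : ℕ)
    (w : W j) : (Psi W ψ j k w : V) = (T ^ k) w := by
  induction k with
  | zero => simp [Psi]
  | succ k ih =>
    rw [pow_succ', Module.End.mul_apply, ← ih, hT]
    simp [Psi]

theorem pow_mem (hT : ∀ (i : ZMod m) (w : W i), T w = ψ i w) {i : ZMod m} {x : V}
    (hx : x ∈ W i) (k : ℕ) : (T ^ k) x ∈ W (i + k) := by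
  have h := coe_Psi_eq_pow hT i k ⟨x, hx⟩
  exact h ▸ (Psi W ψ i k ⟨x, hx⟩).2

theorem pow_val_sub_mem [NeZero m] (hT : ∀ (i : ZMod m) (w : W i), T w = ψ i w) {i : ZMod m}
    {x : V} (hx : x ∈ W i) (j : ZMod m) : (T ^ (j - i).val) x ∈ W j := by
  simpa using pow_mem hT hx (j - i).val

theorem pow_card_eq_one (hT : ∀ (i : ZMod m) (w : W i), T w = ψ i w)
    (hSpan : (⨆ j : ZMod m, W j) = ⊤)
    (hψ : ∀ (j : ZMod m) (w : W j), ((Psi W ψ j m) w : V) = (w : V)) : T ^ m = 1 := by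
  ext v
  have hv : v ∈ ⨆ j : ZMod m, W j := hSpan ▸ Submodule.mem_top
  induction hv using Submodule.iSup_induction' with
  | mem i x hx => rw [← coe_Psi_eq_pow hT i m ⟨x, hx⟩, hψ]; rfl
  | zero => simp
  | add x y _ _ hx hy => rw [map_add, map_add, hx, hy]

theorem pow_eq_pow_of_natCast_eq (hTm : T ^ m = 1) {a b : ℕ} (h : (a : ZMod m) = b) :
    T ^ a = T ^ b := by
  rw [pow_eq_pow_mod a hTm, pow_eq_pow_mod b hTm, (ZMod.natCast_eq_natCast_iff a b m).1 h]

variable {N₂ : Type*} [Group N₂] [MulAction N₂ (ZMod m)] {ρ : N₂ →* (V ≃ₗ[ℂ] V)}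

theorem map_mem (hWρ : ∀ (g : N₂) (j : ZMod m), (W j).map (ρ g).toLinearMap = W (g • j))
    (g : N₂) {i : ZMod m} {x : V} (hx : x ∈ W i) : ρ g x ∈ W (g • i) :=
  hWρ g i ▸ Submodule.mem_map_of_mem hx

theorem rho_apply_eq_pow (hT : ∀ (i : ZMod m) (w : W i), T w = ψ i w)
    (hWρ : ∀ (g : N₂) (j : ZMod m), (W j).map (ρ g).toLinearMap = W (g • j))
    (hψ : IsClutch ρ W ψ) (g : N₂) {i : ZMod m} {x : V} (hx : x ∈ W i) :
    ρ g (T x) = (T ^ (g • (i + 1) - g • i).val) (ρ g x) := by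
  have hmem : x ∈ W (g⁻¹ • g • i) := by rwa [inv_smul_smul]
  have h := hψ.2 (g • i) g ⟨ρ g x, map_mem hWρ g hx⟩ ⟨x, hmem⟩ (by simp)
  rw [coe_Psi_eq_pow hT, ← hT] at h
  simp only [inv_smul_smul] at h
  exact h.symm

theorem rho_pow_apply [NeZero m] (hT : ∀ (i : ZMod m) (w : W i), T w = ψ i w)
    (hTm : T ^ m = 1)
    (hWρ : ∀ (g : N₂) (j : ZMod m), (W j).map (ρ g).toLinearMap = W (g • j))
    (hψ : IsClutch ρ W ψ) (g : N₂) {i : ZMod m} {x : V} (hx : x ∈ W i) (k : ℕ) :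
    ρ g ((T ^ k) x) = (T ^ (g • (i + (k : ZMod m)) - g • i).val) (ρ g x) := by
  induction k with
  | zero => simp
  | succ k ih =>
    rw [pow_succ', Module.End.mul_apply, rho_apply_eq_pow hT hWρ hψ g (pow_mem hT hx k), ih,
      ← Module.End.mul_apply, ← pow_add]
    refine LinearMap.congr_fun (pow_eq_pow_of_natCast_eq hTm ?_) _
    push_cast [ZMod.natCast_zmod_val]
    rw [add_assoc]
    abel

theorem rho_pow_val_sub_apply [NeZero m] (hT : ∀ (i : ZMod m) (w : W i), T w = ψ i w)
    (hTm : T ^ m = 1)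
    (hWρ : ∀ (g : N₂) (j : ZMod m), (W j).map (ρ g).toLinearMap = W (g • j))
    (hψ : IsClutch ρ W ψ) (g : N₂) {i : ZMod m} {x : V} (hx : x ∈ W i) (j : ZMod m) :
    ρ g ((T ^ (j - i).val) x) = (T ^ (g • j - g • i).val) (ρ g x) := by
  simpa using rho_pow_apply hT hTm hWρ hψ g hx (j - i).val

theorem pow_sub_apply_self [NeZero m] (hTm : T ^ m = 1) (i j : ZMod m) (x : V) :
    (T ^ (i - j).val) ((T ^ (j - i).val) x) = x := by
  rw [← Module.End.mul_apply, ← pow_add,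
    pow_eq_pow_of_natCast_eq hTm (b := 0) (by simp), pow_zero, Module.End.one_apply]

theorem sub_pow_mem (hT : ∀ (i : ZMod m) (w : W i), T w = ψ i w) {U : Submodule ℂ V}
    (hU : ∀ (i : ZMod m) (x : V), x ∈ W i → x - T x ∈ U) {i : ZMod m} {x : V}
    (hx : x ∈ W i) (k : ℕ) : x - (T ^ k) x ∈ U := by
  induction k with
  | zero => simp
  | succ k ih =>
    have h := U.add_mem ih (hU _ _ (pow_mem hT hx k))
    rwa [sub_add_sub_cancel, ← Module.End.mul_apply, ← pow_succ'] at h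

end Extension

/-- A subspace mapped into itself by `ρ g` and `ρ g⁻¹` is `ρ g`-invariant. -/
theorem map_eq_of_map_le {G V : Type*} [Group G] [AddCommGroup V] [Module ℂ V]
    (ρ : G →* (V ≃ₗ[ℂ] V)) {U : Submodule ℂ V} {g : G}
    (h : U.map (ρ g).toLinearMap ≤ U) (h' : U.map (ρ g⁻¹).toLinearMap ≤ U) :
    U.map (ρ g).toLinearMap = U := by
  refine le_antisymm h fun x hx ↦ ⟨ρ g⁻¹ x, h' (Submodule.mem_map_of_mem hx), ?_⟩
  simp

/-- restriction of an equivariant pointwise clutching map to a pair of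
points.  For `ψ ∈ 𝒜` and `j ≠ j'` with `B = Ψ_j^k`, `B' = Ψ_{j'}^{k'}` (`k, k'`
representing `j' - j`, `j - j'`): (a) `B' = B⁻¹`, `B` commutes with `ρ g` for `g ∈ P`
fixing `j` and `j'`, and `ρ(g) ∘ B ∘ ρ(g)⁻¹ = B⁻¹` for `g ∈ P` swapping `j` and `j'`;
(b) `U_ψ` and `U' = span {w - B w}` are `P`-invariant, and there is a `P`-equivariant
isomorphism `V ⧸ U_ψ ≃ (W j ⊔ W j') ⧸ U'`. -/
theorem stmt_16 {N₂ : Type*} [Group N₂] [MulAction N₂ (ZMod m)]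
    {V : Type*} [AddCommGroup V] [Module ℂ V] [FiniteDimensional ℂ V]
    (hm : 2 ≤ m)
    (ρ : N₂ →* (V ≃ₗ[ℂ] V)) (W : ZMod m → Submodule ℂ V)
    (hIndep : ∀ j : ZMod m, Disjoint (W j) (⨆ k : ZMod m, ⨆ (_ : k ≠ j), W k))
    (hSpan : (⨆ j : ZMod m, W j) = ⊤)
    (hWρ : ∀ (g : N₂) (j : ZMod m), (W j).map (ρ g).toLinearMap = W (g • j))
    (hfib : ∀ j j' : ZMod m, ∃ e : W j ≃ₗ[ℂ] W j',
      ∀ g : N₂, InKernel (m := m) N₂ g → IsEquivariantOn ρ e g)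
    (ψ : ∀ j : ZMod m, W j ≃ₗ[ℂ] W (j + 1)) (hψ : IsClutch ρ W ψ)
    (j j' : ZMod m) (hjj' : j ≠ j')
    (U U' : Submodule ℂ V)
    (hU : U = Submodule.span ℂ
      {v : V | ∃ (i : ZMod m) (w : W i), v = (w : V) - ((ψ i) w : V)})
    (hU' : U' = Submodule.span ℂ
      {v : V | ∃ w : W j, v = (w : V) - ((Psi W ψ j ((j' - j).val)) w : V)}) :
    -- (a) `B' = B⁻¹` …
    ((∀ (w : W j) (u : W j'),
        (u : V) = ((Psi W ψ j ((j' - j).val)) w : V) →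
        ((Psi W ψ j' ((j - j').val)) u : V) = (w : V)) ∧
      -- … `ρ(g) ∘ B ∘ ρ(g)⁻¹ = B` for `g ∈ P` fixing `j` and `j'` …
      (∀ g : N₂, g • j = j → g • j' = j' →
        IsEquivariantOn ρ (Psi W ψ j ((j' - j).val)) g) ∧
      -- … and `ρ(g) ∘ B ∘ ρ(g)⁻¹ = B⁻¹ : W j' → W j` for `g ∈ P` swapping `j` and `j'`.
      (∀ g : N₂, g • j = j' → g • j' = j →
        ∀ (u : W j') (u' : W (j + (((j' - j).val : ℕ) : ZMod m))) (w : W j),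
          (u' : V) = (u : V) → (w : V) = ρ g⁻¹ (u : V) →
          ρ g (((Psi W ψ j ((j' - j).val)) w : V)) =
            (((Psi W ψ j ((j' - j).val)).symm u' : V)))) ∧
    -- (b) `U_ψ` and `U'` are `P`-invariant …
    ((∀ g : N₂, ((g • j = j ∧ g • j' = j') ∨ (g • j = j' ∧ g • j' = j)) →
        U.map (ρ g).toLinearMap = U ∧ U'.map (ρ g).toLinearMap = U') ∧
      -- … and there is a `P`-equivariant isomorphism `V ⧸ U_ψ ≃ (W j ⊔ W j') ⧸ U'`.
      ∃ e : (V ⧸ U) ≃ₗ[ℂ] ((W j ⊔ W j' : Submodule ℂ V) ⧸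
          (U'.comap (W j ⊔ W j' : Submodule ℂ V).subtype)),
        ∀ g : N₂, ((g • j = j ∧ g • j' = j') ∨ (g • j = j' ∧ g • j' = j)) →
          ∀ (v : V) (s s' : (W j ⊔ W j' : Submodule ℂ V)),
            e (Submodule.Quotient.mk v) = Submodule.Quotient.mk s →
            (s' : V) = ρ g (s : V) →
            e (Submodule.Quotient.mk (ρ g v)) = Submodule.Quotient.mk s') := by
  have : NeZero m := ⟨by omega⟩
  obtain ⟨T, hT⟩ := exists_linearMap_of_iSupIndep (W := W) hIndep hSpan
    fun i ↦ (W (i + 1)).subtype ∘ₗ (ψ i).toLinearMap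
  replace hT : ∀ (i : ZMod m) (w : W i), T w = ψ i w := hT
  have hTm := pow_card_eq_one hT hSpan hψ.1
  have hconj : ∀ (g : N₂) {i : ZMod m} {x : V}, x ∈ W i → ∀ l : ZMod m,
      ρ g ((T ^ (l - i).val) x) = (T ^ (g • l - g • i).val) (ρ g x) :=
    fun g _ _ hx l ↦ rho_pow_val_sub_apply hT hTm hWρ hψ g hx l
  have hUgen : ∀ (i : ZMod m) (x : V), x ∈ W i → x - T x ∈ U := fun i x hx ↦ by
    rw [hU]
    exact Submodule.subset_span ⟨i, ⟨x, hx⟩, by rw [← hT]⟩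
  have hU'gen : ∀ x ∈ W j, x - (T ^ (j' - j).val) x ∈ U' := fun x hx ↦ by
    rw [hU']
    exact Submodule.subset_span ⟨⟨x, hx⟩, by rw [coe_Psi_eq_pow hT]⟩
  have hU'gen' : ∀ x ∈ W j', x - (T ^ (j - j').val) x ∈ U' := fun x hx ↦ by
    have h := U'.neg_mem (hU'gen _ (pow_val_sub_mem hT hx j))
    rwa [pow_sub_apply_self hTm, neg_sub] at h
  have hUmap : ∀ g : N₂, U.map (ρ g).toLinearMap ≤ U := fun g ↦ by
    conv_lhs => rw [hU]
    rw [Submodule.map_span_le]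
    rintro _ ⟨i, w, rfl⟩
    rw [← hT, LinearEquiv.coe_coe, map_sub, rho_apply_eq_pow hT hWρ hψ g w.2]
    exact sub_pow_mem hT hUgen (map_mem hWρ g w.2) _
  have hU'map : ∀ g : N₂, ((g • j = j ∧ g • j' = j') ∨ (g • j = j' ∧ g • j' = j)) →
      U'.map (ρ g).toLinearMap ≤ U' := fun g hg ↦ by
    conv_lhs => rw [hU']
    rw [Submodule.map_span_le]
    rintro _ ⟨w, rfl⟩
    have hgw := map_mem hWρ g w.2
    rw [coe_Psi_eq_pow hT, LinearEquiv.coe_coe, map_sub, hconj g w.2]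
    rcases hg with ⟨h₁, h₂⟩ | ⟨h₁, h₂⟩
    · rw [h₁] at hgw
      rw [h₁, h₂]
      exact hU'gen _ hgw
    · rw [h₁] at hgw
      rw [h₁, h₂]
      exact hU'gen' _ hgw
  refine ⟨⟨?_, ?_, ?_⟩, ?_, ?_⟩
  · intro w u hu
    rw [coe_Psi_eq_pow hT] at hu ⊢
    rw [hu, pow_sub_apply_self hTm]
  · intro g h₁ h₂ w w' hw
    rw [coe_Psi_eq_pow hT, coe_Psi_eq_pow hT, hw, hconj g w.2, h₁, h₂]
  · intro g h₁ h₂ u u' w hu hw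
    obtain ⟨v, rfl⟩ := (Psi W ψ j (j' - j).val).surjective u'
    rw [LinearEquiv.symm_apply_apply, coe_Psi_eq_pow hT, hconj g w.2, h₁, h₂, hw]
    rw [coe_Psi_eq_pow hT] at hu
    have hgu : ρ g (ρ g⁻¹ (u : V)) = u := by simp
    rw [hgu, ← hu, pow_sub_apply_self hTm]
  · intro g hg
    have hg' : (g⁻¹ • j = j ∧ g⁻¹ • j' = j') ∨ (g⁻¹ • j = j' ∧ g⁻¹ • j' = j) := by
      simp only [inv_smul_eq_iff]
      tauto
    exact ⟨map_eq_of_map_le ρ (hUmap g) (hUmap g⁻¹),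
      map_eq_of_map_le ρ (hU'map g hg) (hU'map g⁻¹ hg')⟩
  · obtain ⟨p, hp⟩ := exists_linearMap_of_iSupIndep (W := W) hIndep hSpan
      fun i ↦ (T ^ (j - i).val) ∘ₗ (W i).subtype
    replace hp : ∀ {i : ZMod m} {x : V}, x ∈ W i → p x = (T ^ (j - i).val) x :=
      fun {i x} hx ↦ hp i ⟨x, hx⟩
    have hpU : U ≤ LinearMap.ker p := by
      rw [hU, Submodule.span_le]
      rintro _ ⟨i, w, rfl⟩
      rw [SetLike.mem_coe, LinearMap.mem_ker, map_sub, hp w.2, hp (ψ i w).2, ← hT,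
        ← Module.End.mul_apply, ← pow_succ, sub_eq_zero]
      exact LinearMap.congr_fun (pow_eq_pow_of_natCast_eq hTm (by push_cast [ZMod.natCast_zmod_val]; ring)) _
    have hU'U : U' ≤ U := by
      rw [hU', Submodule.span_le]
      rintro _ ⟨w, rfl⟩
      rw [coe_Psi_eq_pow hT]
      exact sub_pow_mem hT hUgen w.2 _
    let S : Submodule ℂ V := W j ⊔ W j'
    let φ : (S ⧸ U'.comap S.subtype) →ₗ[ℂ] V ⧸ U :=
      (U'.comap S.subtype).mapQ U S.subtype (Submodule.comap_mono hU'U)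
    have hφ : ∀ s : S, φ (Submodule.Quotient.mk s) = Submodule.Quotient.mk (s : V) :=
      fun s ↦ Submodule.mapQ_apply _ _ _ s
    have hinj : Function.Injective φ := by
      rw [← LinearMap.ker_eq_bot, LinearMap.ker_eq_bot']
      intro q hq
      obtain ⟨s, rfl⟩ := Submodule.Quotient.mk_surjective _ q
      rw [hφ, Submodule.Quotient.mk_eq_zero] at hq
      rw [Submodule.Quotient.mk_eq_zero, Submodule.mem_comap, Submodule.subtype_apply]
      obtain ⟨a, ha, b, hb, hab⟩ := Submodule.mem_sup.1 s.2
      have h := hpU hq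
      rw [← hab, LinearMap.mem_ker, map_add, hp ha, hp hb, sub_self, ZMod.val_zero, pow_zero,
        Module.End.one_apply, add_eq_zero_iff_eq_neg] at h
      rw [← hab, h, neg_add_eq_sub]
      exact hU'gen' b hb
    have hsurj : Function.Surjective φ := by
      intro q
      obtain ⟨v, rfl⟩ := Submodule.Quotient.mk_surjective _ q
      rw [← LinearMap.mem_range]
      have hv : v ∈ ⨆ i : ZMod m, W i := hSpan ▸ Submodule.mem_top
      induction hv using Submodule.iSup_induction' with
      | mem i x hx =>
        refine ⟨Submodule.Quotient.mk
          ⟨(T ^ (j - i).val) x, Submodule.mem_sup_left (pow_val_sub_mem hT hx j)⟩, ?_⟩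
        rw [hφ, eq_comm, Submodule.Quotient.eq]
        exact sub_pow_mem hT hUgen hx _
      | zero => exact Submodule.zero_mem _
      | add x y _ _ hx hy => exact Submodule.add_mem _ hx hy
    have hbij : Function.Bijective φ := ⟨hinj, hsurj⟩
    refine ⟨(LinearEquiv.ofBijective φ hbij).symm, fun g _ v s s' hs hs' ↦ ?_⟩
    rw [LinearEquiv.symm_apply_eq, LinearEquiv.ofBijective_apply, hφ, Submodule.Quotient.eq] at hs ⊢
    rw [hs', ← map_sub]
    exact hUmap g (Submodule.mem_map_of_mem hs)

end EqClutch
end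
end
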